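/- Two sequences (s_j) and (t_j) satisfy s_j^{(1,α)} = t_j^{(1,α)} for all 0 ≤ j ≤ κ−1 together with s_0 = t_0 if and only if s_0 s_0^{+} s_j s_0^{+} s_0 = t_0 t_0^{+} t_j t_0^{+} t_0 for all 0 ≤ j ≤ κ. -/

import Mathlib

open Matrix BigOperators

def IsMP {m n : Type*} [Fintype m] [Fintype n] (A : Matrix m n ℂ) (B : Matrix n m ℂ) : Prop :=
  A * B * A = A ∧ B * A * B = B ∧ (A * B)ᴴ = A * B ∧ (B * A)ᴴ = B * A

open Classical in
noncomputable def mp {m n : Type*} [Fintype m] [Fintype n] (A : Matrix m n ℂ) : Matrix n m ℂ :=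
  if h : ∃ B, IsMP A B then h.choose else 0

noncomputable def recip {p q : ℕ} (s : ℕ → Matrix (Fin p) (Fin q) ℂ) :
    ℕ → Matrix (Fin q) (Fin p) ℂ
  | 0 => mp (s 0)
  | (j+1) => -(mp (s 0) * ∑ l : Fin (j+1), s (j+1 - l.val) * recip s l.val)
termination_by j => j
decreasing_by exact l.isLt

noncomputable def shiftA {p q : ℕ} (α : ℂ) (s : ℕ → Matrix (Fin p) (Fin q) ℂ) :
    ℕ → Matrix (Fin p) (Fin q) ℂ
  | 0 => s 0
  | (j+1) => (-α) • s j + s (j+1)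

noncomputable def recipA {p q : ℕ} (α : ℂ) (s : ℕ → Matrix (Fin p) (Fin q) ℂ) :
    ℕ → Matrix (Fin q) (Fin p) ℂ :=
  recip (shiftA α s)

theorem Matrix.IsHermitian.exists_commuting_generalized_inverse {n : Type*} [Fintype n]
    {H : Matrix n n ℂ} (hH : H.IsHermitian) :
    ∃ K : Matrix n n ℂ, K.IsHermitian ∧ H * K = K * H ∧ H * K * H = H ∧ K * H * K = K := by
  classical
  set U : Matrix n n ℂ := (hH.eigenvectorUnitary : Matrix n n ℂ)
  set d : n → ℂ := fun i => (hH.eigenvalues i : ℂ)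
  have hU : star U * U = 1 := Unitary.coe_star_mul_self hH.eigenvectorUnitary
  have hsp : H = U * diagonal d * star U := hH.spectral_theorem
  have hmul (a b : n → ℂ) : U * diagonal a * star U * (U * diagonal b * star U) =
      U * diagonal (fun i => a i * b i) * star U := by
    rw [← diagonal_mul_diagonal]
    simp only [Matrix.mul_assoc]
    rw [← Matrix.mul_assoc (star U) U, hU, Matrix.one_mul]
  refine ⟨U * diagonal (fun i => (d i)⁻¹) * star U, ?_, ?_, ?_, ?_⟩
  · have hd : (diagonal (fun i => (d i)⁻¹)).IsHermitian := by
      refine isHermitian_diagonal_of_self_adjoint _ (funext fun i => ?_)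
      simp [d]
    exact isHermitian_mul_mul_conjTranspose U hd
  · simp only [hsp, hmul, mul_comm]
  · simp only [hsp, hmul, mul_inv_mul_cancel]
  · have hd (i : n) : (d i)⁻¹ * d i * (d i)⁻¹ = (d i)⁻¹ := by
      simpa only [inv_inv] using mul_inv_mul_cancel (d i)⁻¹
    simp only [hsp, hmul, hd]

open scoped ComplexOrder in
theorem exists_isMP {m n : Type*} [Fintype m] [Fintype n] (A : Matrix m n ℂ) :
    ∃ B, IsMP A B := by
  classical
  obtain ⟨K, hK, hc, h1, h2⟩ :=
    (isHermitian_conjTranspose_mul_self A).exists_commuting_generalized_inverse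
  refine ⟨K * Aᴴ, ?_, ?_, ?_, ?_⟩
  · have h0 : Aᴴ * A * (K * (Aᴴ * A) - 1) = 0 := by
      rw [Matrix.mul_sub, ← Matrix.mul_assoc, h1, Matrix.mul_one, sub_self]
    rw [conjTranspose_mul_self_mul_eq_zero, Matrix.mul_sub, Matrix.mul_one, sub_eq_zero] at h0
    simpa only [Matrix.mul_assoc] using h0
  · calc K * Aᴴ * A * (K * Aᴴ) = K * (Aᴴ * A) * K * Aᴴ := by simp only [Matrix.mul_assoc]
      _ = K * Aᴴ := by rw [h2]
  · rw [← Matrix.mul_assoc]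
    exact isHermitian_mul_mul_conjTranspose A hK
  · rw [Matrix.mul_assoc, conjTranspose_mul, (isHermitian_conjTranspose_mul_self A).eq, hK.eq, hc]

theorem isMP_mp {m n : Type*} [Fintype m] [Fintype n] (A : Matrix m n ℂ) : IsMP A (mp A) := by
  rw [mp, dif_pos (exists_isMP A)]
  exact (exists_isMP A).choose_spec

theorem IsMP.mul_mul_mul_mul_inj {m n : Type*} [Fintype m] [Fintype n] {A : Matrix m n ℂ}
    {G : Matrix n m ℂ} (h : IsMP A G) {X Y : Matrix m n ℂ} :
    A * G * X * G * A = A * G * Y * G * A ↔ G * X * G = G * Y * G := by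
  have hsplit (Z : Matrix m n ℂ) : A * G * Z * G * A = A * (G * Z * G) * A := by
    simp only [Matrix.mul_assoc]
  have hback (Z : Matrix m n ℂ) : G * (A * G * Z * G * A) * G = G * Z * G := by
    calc G * (A * G * Z * G * A) * G = (G * A * G) * Z * (G * A * G) := by
          simp only [Matrix.mul_assoc]
      _ = G * Z * G := by rw [h.2.1]
  exact ⟨fun e => by rw [← hback X, e, hback], fun e => by rw [hsplit, e, hsplit]⟩

theorem mp_mul_self_mul_recip {p q : ℕ} (u : ℕ → Matrix (Fin p) (Fin q) ℂ) (j : ℕ) :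
    mp (u 0) * u 0 * recip u j = recip u j := by
  have h := (isMP_mp (u 0)).2.1
  cases j with
  | zero => rw [recip, h]
  | succ j => rw [recip, Matrix.mul_neg, ← Matrix.mul_assoc, h]

theorem recip_succ {p q : ℕ} (u : ℕ → Matrix (Fin p) (Fin q) ℂ) (j : ℕ) :
    recip u (j + 1) = -(∑ l : Fin j,
      mp (u 0) * u (j - l) * mp (u 0) * (u 0 * recip u (l + 1)) +
        mp (u 0) * u (j + 1) * mp (u 0)) := by
  rw [recip, Fin.sum_univ_succ, Matrix.mul_add, Matrix.mul_sum, add_comm]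
  congr 2
  · refine Finset.sum_congr rfl fun l _ => ?_
    rw [Fin.val_succ, Nat.add_sub_add_right]
    conv_lhs => rw [← mp_mul_self_mul_recip u (l + 1)]
    simp only [Matrix.mul_assoc]
  · rw [Fin.val_zero, Nat.sub_zero, recip, Matrix.mul_assoc]

theorem recip_eq_iff {p q : ℕ} {u v : ℕ → Matrix (Fin p) (Fin q) ℂ} (h0 : u 0 = v 0) (n : ℕ) :
    (∀ j ≤ n, recip u j = recip v j) ↔
      ∀ j ≤ n, mp (u 0) * u j * mp (u 0) = mp (u 0) * v j * mp (u 0) := by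
  induction n with
  | zero => simp [recip, h0]
  | succ n ih =>
    simp only [Nat.le_succ_iff, or_imp, forall_and, forall_eq, ih]
    refine and_congr_right fun hG => ?_
    have hr := ih.2 hG
    have hsum : ∑ l : Fin n, mp (u 0) * u (n - l) * mp (u 0) * (u 0 * recip u (l + 1)) =
        ∑ l : Fin n, mp (u 0) * v (n - l) * mp (u 0) * (u 0 * recip v (l + 1)) :=
      Finset.sum_congr rfl fun l _ => by rw [hG _ (Nat.sub_le _ _), hr _ (by omega)]
    rw [Nat.succ_eq_add_one, recip_succ u, recip_succ v, ← h0, hsum, neg_inj, add_right_inj]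

theorem mul_shiftA_mul_eq_iff {p q : ℕ} (α : ℂ) {s t : ℕ → Matrix (Fin p) (Fin q) ℂ}
    (G : Matrix (Fin q) (Fin p) ℂ) (n : ℕ) :
    (∀ j ≤ n, G * shiftA α s j * G = G * shiftA α t j * G) ↔
      ∀ j ≤ n, G * s j * G = G * t j * G := by
  induction n with
  | zero => simp [shiftA]
  | succ n ih =>
    simp only [Nat.le_succ_iff, or_imp, forall_and, forall_eq, ih]
    refine and_congr_right fun hG => ?_
    simp only [Nat.succ_eq_add_one, shiftA, Matrix.mul_add, Matrix.add_mul, Matrix.mul_smul,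
      Matrix.smul_mul, hG n le_rfl, add_right_inj]

theorem recipA_eq_iff {p q : ℕ} (α : ℂ) {s t : ℕ → Matrix (Fin p) (Fin q) ℂ} (h0 : s 0 = t 0)
    (n : ℕ) :
    (∀ j ≤ n, recipA α s j = recipA α t j) ↔
      ∀ j ≤ n, s 0 * mp (s 0) * s j * mp (s 0) * s 0 = t 0 * mp (t 0) * t j * mp (t 0) * t 0 := by
  simp only [← h0, (isMP_mp (s 0)).mul_mul_mul_mul_inj]
  have h := recip_eq_iff (u := shiftA α s) (v := shiftA α t) (by simpa only [shiftA] using h0) n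
  rw [show shiftA α s 0 = s 0 by rw [shiftA]] at h
  exact h.trans (mul_shiftA_mul_eq_iff α _ n)

/-- Lemma 5.10: equality of shortened negative α-reciprocal sequences together
    with equality of the first matrices is equivalent to
    s_0 s_0^+ s_j s_0^+ s_0 = t_0 t_0^+ t_j t_0^+ t_0 for all j. -/
theorem stmt8 {p q : ℕ} (α : ℂ) (κ : ℕ∞) (hκ : 1 ≤ κ)
    (s t : ℕ → Matrix (Fin p) (Fin q) ℂ) :
    ((∀ j : ℕ, (j : ℕ∞) + 1 ≤ κ → -(recipA α s (j + 1)) = -(recipA α t (j + 1))) ∧ s 0 = t 0) ↔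
      (∀ j : ℕ, (j : ℕ∞) ≤ κ →
        s 0 * mp (s 0) * s j * mp (s 0) * s 0 = t 0 * mp (t 0) * t j * mp (t 0) * t 0) := by
  have hle {n j : ℕ} (hn : (n : ℕ∞) ≤ κ) (hj : j ≤ n) : (j : ℕ∞) ≤ κ :=
    (Nat.cast_le.2 hj).trans hn
  constructor
  · rintro ⟨h, h0⟩ n hn
    refine (recipA_eq_iff α h0 n).1 (fun j hj => ?_) n le_rfl
    cases j with
    | zero => simp only [recipA, recip, shiftA, h0]
    | succ j => exact neg_inj.1 (h j (by exact_mod_cast hle hn hj))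
  · intro h
    have hself (A : Matrix (Fin p) (Fin q) ℂ) : A * mp A * A * mp A * A = A := by
      rw [(isMP_mp A).1, (isMP_mp A).1]
    have h0 : s 0 = t 0 := by simpa only [hself] using h 0 zero_le
    refine ⟨fun j hj => neg_inj.2 ?_, h0⟩
    exact (recipA_eq_iff α h0 (j + 1)).2 (fun i hi => h i (hle (by exact_mod_cast hj) hi)) _ le_rfl
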